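/- arXiv:1904.13256 — 12 statements merged into one kernel-verified Lean document; each statement's English description precedes it below -/
import Mathlib

section
/- Let A be an n×n matrix over the max-plus algebra whose diagonal entries a_{11}, …, a_{nn} are all finite and which satisfies Σ_{i=1}^n a_{iσ(i)} ≤ Σ_{i=1}^n a_{ii} for every permutation σ of {1,…,n} (i.e. det_ε(A) = a_{11} + ⋯ + a_{nn}). Then A = L_A U_A if and only if for all indices i, j with 1 < i, j ≤ n and i ≠ j one has a_{ij} = max_{k=1}^{min(i,j)−1} ( max(a_{kk} + a_{ij}, a_{ik} + a_{kj}) − a_{kk} ). -/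
open Finset

noncomputable section

/-- The max-plus algebra `ℝ ∪ {−∞}`: the lattice `max` (i.e. `⊔`) is the semiring
addition and `+` (with `⊥ = −∞` absorbing) is the semiring multiplication. -/
abbrev Rmax : Type := WithBot ℝ

/-- Max-plus matrix product: `(A ⬝ B) i j = max_k (A i k + B k j)`. -/
def mpMulMat {n : ℕ} (A B : Fin n → Fin n → Rmax) : Fin n → Fin n → Rmax :=
  fun i j => univ.sup fun k => A i k + B k j

/-- Max-plus matrix-vector product: `(A ⬝ x) i = max_k (A i k + x k)`. -/
def mpMulVec {n : ℕ} (A : Fin n → Fin n → Rmax) (x : Fin n → Rmax) : Fin n → Rmax :=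
  fun i => univ.sup fun k => A i k + x k

/-- The lower triangular factor `L_A` of `A`, whose (finite) diagonal entries are
given by the real vector `d` (so `(L_A) i j = A i j − A j j` for `j ≤ i`). -/
def Lfac {n : ℕ} (A : Fin n → Fin n → Rmax) (d : Fin n → ℝ) : Fin n → Fin n → Rmax :=
  fun i j => if j ≤ i then A i j + ((-(d j) : ℝ) : Rmax) else ⊥

/-- The upper triangular factor `U_A` of `A`. -/
def Ufac {n : ℕ} (A : Fin n → Fin n → Rmax) : Fin n → Fin n → Rmax :=
  fun i j => if i ≤ j then A i j else ⊥

theorem mp_cancel (x : Rmax) (c : ℝ) : (c : Rmax) + x + ((-c : ℝ) : Rmax) = x := by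
  rw [add_right_comm, ← WithBot.coe_add, add_neg_cancel, WithBot.coe_zero, zero_add]

theorem mp_diag {n : ℕ} (A : Fin n → Fin n → Rmax) (d : Fin n → ℝ)
    (hdiag : ∀ i, A i i = (d i : Rmax))
    (hdet : ∀ σ : Equiv.Perm (Fin n), ∑ i, A i (σ i) ≤ ∑ i, A i i) (i k : Fin n) (hik : k ≠ i) :
    A i k + A k i + ((-(d k) : ℝ) : Rmax) ≤ A i i := by
  have h := hdet (Equiv.swap i k)
  have hk : k ∈ (univ : Finset (Fin n)).erase i := by simp [hik]
  rw [← Finset.add_sum_erase _ _ (mem_univ i), ← Finset.add_sum_erase _ _ hk,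
    ← Finset.add_sum_erase _ (fun i => A i i) (mem_univ i),
    ← Finset.add_sum_erase _ (fun i => A i i) hk] at h
  have e : ∑ x ∈ ((univ : Finset (Fin n)).erase i).erase k, A x (Equiv.swap i k x)
      = ∑ x ∈ ((univ : Finset (Fin n)).erase i).erase k, A x x := by
    apply Finset.sum_congr rfl
    intro x hx
    simp only [mem_erase, mem_univ, and_true] at hx
    rw [Equiv.swap_apply_of_ne_of_ne hx.2 hx.1]
  have e2 : ∑ x ∈ ((univ : Finset (Fin n)).erase i).erase k, A x x
      = ((∑ x ∈ ((univ : Finset (Fin n)).erase i).erase k, d x : ℝ) : Rmax) := by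
    rw [WithBot.coe_sum]
    exact Finset.sum_congr rfl fun x _ => hdiag x
  rw [e, e2] at h
  simp only [Equiv.swap_apply_left, Equiv.swap_apply_right, hdiag] at h ⊢
  generalize (∑ x ∈ ((univ : Finset (Fin n)).erase i).erase k, d x) = S at h
  generalize A i k = x at h ⊢
  generalize A k i = y at h ⊢
  induction x using WithBot.recBotCoe with
  | bot => simp
  | coe x =>
    induction y using WithBot.recBotCoe with
    | bot => simp
    | coe y =>
      norm_cast at h ⊢
      linarith

theorem mp_lhs {n : ℕ} (A : Fin n → Fin n → Rmax) (d : Fin n → ℝ)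
    (hdiag : ∀ i, A i i = (d i : Rmax)) :
    mpMulMat (Lfac A d) (Ufac A) = A ↔
      ∀ i j k : Fin n, k ≤ i → k ≤ j → A i k + A k j + ((-(d k) : ℝ) : Rmax) ≤ A i j := by
  constructor
  · intro h i j k hi hj
    have h1 := congrFun (congrFun h i) j
    rw [← h1]
    have := Finset.le_sup (f := fun k => Lfac A d i k + Ufac A k j) (mem_univ k)
    simp only [Lfac, Ufac, hi, hj, if_true] at this
    rw [add_right_comm] at this
    exact this
  · intro h
    funext i j
    apply le_antisymm
    · apply Finset.sup_le
      intro k _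
      unfold Lfac Ufac
      split_ifs with h1 h2
      · rw [add_right_comm]
        exact h i j k h1 h2
      all_goals simp
    · rcases le_total i j with hij | hij
      · have := Finset.le_sup (f := fun k => Lfac A d i k + Ufac A k j) (mem_univ i)
        simp only [Lfac, Ufac, hij, le_refl, if_true] at this
        rw [add_right_comm, hdiag, mp_cancel] at this
        exact this
      · have := Finset.le_sup (f := fun k => Lfac A d i k + Ufac A k j) (mem_univ j)
        simp only [Lfac, Ufac, hij, le_refl, if_true] at this
        rw [add_right_comm, hdiag, add_comm (A i j), mp_cancel] at this
        exact this

/-- For a square max-plus matrix `A` with finite diagonal entries `d`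
satisfying `det_ε(A) = a₁₁ + ⋯ + aₙₙ`, one has `A = L_A U_A` iff for all `1 < i, j ≤ n`
with `i ≠ j`, `a i j = max_{k < min i j} (max(a k k + a i j, a i k + a k j) − a k k)`. -/
theorem maxplus_LU_factorization_iff {n : ℕ} (A : Fin n → Fin n → Rmax) (d : Fin n → ℝ)
    (hdiag : ∀ i, A i i = (d i : Rmax))
    (hdet : ∀ σ : Equiv.Perm (Fin n), ∑ i, A i (σ i) ≤ ∑ i, A i i) :
    mpMulMat (Lfac A d) (Ufac A) = A ↔
      ∀ i j : Fin n, (i : ℕ) ≠ 0 → (j : ℕ) ≠ 0 → i ≠ j →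
        A i j =
          (univ.filter fun k : Fin n => (k : ℕ) < min (i : ℕ) (j : ℕ)).sup
            (fun k => max (A k k + A i j) (A i k + A k j) + ((-(d k) : ℝ) : Rmax)) := by
  rw [mp_lhs A d hdiag]
  constructor
  · intro h i j hi hj hij
    apply le_antisymm
    · have h0 : (⟨0, i.pos⟩ : Fin n) ∈
          univ.filter fun k : Fin n => (k : ℕ) < min (i : ℕ) (j : ℕ) := by
        simp only [mem_filter, mem_univ, true_and, lt_min_iff]
        exact ⟨Nat.pos_of_ne_zero hi, Nat.pos_of_ne_zero hj⟩
      refine le_trans ?_ (Finset.le_sup h0)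
      refine le_trans ?_ (add_le_add_left (le_max_left _ _) _)
      rw [hdiag, mp_cancel]
    · apply Finset.sup_le
      intro k hk
      simp only [mem_filter, mem_univ, true_and, lt_min_iff] at hk
      rcases max_choice (A k k + A i j) (A i k + A k j) with e | e
      · rw [e, hdiag, mp_cancel]
      · rw [e]
        exact h i j k (Fin.le_def.2 hk.1.le) (Fin.le_def.2 hk.2.le)
  · intro h i j k hi hj
    rcases eq_or_ne k i with rfl | hki
    · rw [hdiag, mp_cancel]
    rcases eq_or_ne k j with rfl | hkj
    · rw [hdiag, add_comm (A i k), mp_cancel]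
    rcases eq_or_ne i j with rfl | hij
    · exact mp_diag A d hdiag hdet i k hki
    have h1 : (k : ℕ) < i := Fin.lt_def.1 (lt_of_le_of_ne hi hki)
    have h2 : (k : ℕ) < j := Fin.lt_def.1 (lt_of_le_of_ne hj hkj)
    rw [h i j (by omega) (by omega) hij]
    have hk : k ∈ univ.filter fun k : Fin n => (k : ℕ) < min (i : ℕ) (j : ℕ) := by
      simp only [mem_filter, mem_univ, true_and, lt_min_iff]
      exact ⟨h1, h2⟩
    refine le_trans ?_ (Finset.le_sup hk)
    exact add_le_add_left (le_max_right _ _) _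
end
end

section
/- Let L be an n×n lower triangular matrix over the max-plus algebra whose diagonal entries l_{11}, …, l_{nn} are all finite, and let b be a regular vector in (ℝ ∪ {−∞})^n. If l_{ik} + b_k ≤ b_i + l_{kk} for all indices 2 ≤ i ≤ n and 1 ≤ k ≤ i−1 (i.e. l_{ik} − l_{kk} ≤ b_i − b_k), then the vector X* with entries x*_i = b_i − l_{ii} is a solution of the system LX = b, and every solution X of LX = b satisfies X ≤ X* entrywise. -/
open Finset

noncomputable section

/-- If `L` is lower triangular with finite diagonal `d` and `b` is regular
(entries are the reals `b i`), and `l i k + b k ≤ b i + l k k` for all `k < i`, then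
`X* = (b i − l i i)` solves `LX = b` and every solution is `≤ X*` entrywise. -/
theorem maxplus_L_system_maximal_solution {n : ℕ} (L : Fin n → Fin n → Rmax)
    (d : Fin n → ℝ) (b : Fin n → ℝ)
    (hLtri : ∀ i j : Fin n, i < j → L i j = ⊥)
    (hdiag : ∀ i, L i i = (d i : Rmax))
    (hineq : ∀ i k : Fin n, k < i → L i k + (b k : Rmax) ≤ (b i : Rmax) + L k k) :
    (∀ i, mpMulVec L (fun j => ((b j - d j : ℝ) : Rmax)) i = (b i : Rmax)) ∧
    ∀ X : Fin n → Rmax, (∀ i, mpMulVec L X i = (b i : Rmax)) →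
      ∀ i, X i ≤ ((b i - d i : ℝ) : Rmax) := by
  constructor
  · intro i
    unfold mpMulVec
    apply le_antisymm
    · apply Finset.sup_le
      intro k _
      rcases lt_trichotomy i k with h | h | h
      · rw [hLtri i k h]; simp
      · subst h
        rw [hdiag, ← WithBot.coe_add]
        exact WithBot.coe_le_coe.2 (by linarith)
      · have h1 := hineq i k h
        rw [hdiag] at h1
        generalize L i k = l at h1
        induction l using WithBot.recBotCoe with
        | bot => simp
        | coe l =>
          rw [← WithBot.coe_add, ← WithBot.coe_add, WithBot.coe_le_coe] at h1
          rw [← WithBot.coe_add, WithBot.coe_le_coe]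
          linarith
    · have h := Finset.le_sup (f := fun k => L i k + ((b k - d k : ℝ) : Rmax)) (Finset.mem_univ i)
      refine le_trans ?_ h
      show (b i : Rmax) ≤ L i i + ((b i - d i : ℝ) : Rmax)
      rw [hdiag, ← WithBot.coe_add]
      exact WithBot.coe_le_coe.2 (by linarith)
  · intro X hX i
    have h : L i i + X i ≤ (b i : Rmax) := by
      rw [← hX i]
      exact Finset.le_sup (f := fun k => L i k + X k) (Finset.mem_univ i)
    rw [hdiag] at h
    generalize X i = x at h
    induction x using WithBot.recBotCoe with
    | bot => simp
    | coe x =>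
      rw [← WithBot.coe_add, WithBot.coe_le_coe] at h
      rw [WithBot.coe_le_coe]
      linarith
end
end

section
/- Let L be an n×n lower triangular matrix over the max-plus algebra whose diagonal entries are all finite, and let b be a regular vector in (ℝ ∪ {−∞})^n. If the strict inequalities l_{ik} + b_k < b_i + l_{kk} hold for all indices 2 ≤ i ≤ n and 1 ≤ k ≤ i−1, then the vector X* with entries x*_i = b_i − l_{ii} is the unique solution of the system LX = b. -/
open Finset

noncomputable section

/-- If `L` is lower triangular with finite diagonal `d`, `b` is regular,
and `l i k + b k < b i + l k k` strictly for all `k < i`, then `X* = (b i − l i i)` is the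
unique solution of `LX = b`. -/
theorem maxplus_L_system_unique_solution {n : ℕ} (L : Fin n → Fin n → Rmax)
    (d : Fin n → ℝ) (b : Fin n → ℝ)
    (hLtri : ∀ i j : Fin n, i < j → L i j = ⊥)
    (hdiag : ∀ i, L i i = (d i : Rmax))
    (hineq : ∀ i k : Fin n, k < i → L i k + (b k : Rmax) < (b i : Rmax) + L k k) :
    (∀ i, mpMulVec L (fun j => ((b j - d j : ℝ) : Rmax)) i = (b i : Rmax)) ∧
    ∀ X : Fin n → Rmax, (∀ i, mpMulVec L X i = (b i : Rmax)) →
      X = fun j => ((b j - d j : ℝ) : Rmax) := by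
  have hlt : ∀ i k : Fin n, k ≠ i → L i k + ((b k - d k : ℝ) : Rmax) < (b i : Rmax) := by
    intro i k hk
    rcases lt_or_gt_of_ne hk with h | h
    · have h1 := hineq i k h
      rw [hdiag] at h1
      generalize L i k = l at h1 ⊢
      induction l using WithBot.recBotCoe with
      | bot => rw [WithBot.bot_add]; exact WithBot.bot_lt_coe _
      | coe l =>
        rw [← WithBot.coe_add, ← WithBot.coe_add, WithBot.coe_lt_coe] at h1
        rw [← WithBot.coe_add, WithBot.coe_lt_coe]
        linarith
    · rw [hLtri i k h, WithBot.bot_add]; exact WithBot.bot_lt_coe _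
  have hd : ∀ i, L i i + ((b i - d i : ℝ) : Rmax) = (b i : Rmax) := by
    intro i
    rw [hdiag, ← WithBot.coe_add, add_sub_cancel]
  constructor
  · intro i
    apply le_antisymm
    · refine Finset.sup_le fun k _ => ?_
      by_cases hk : k = i
      · subst hk; exact (hd k).le
      · exact (hlt i k hk).le
    · rw [← hd i]
      exact Finset.le_sup (f := fun k => L i k + ((b k - d k : ℝ) : Rmax)) (mem_univ i)
  · intro X hX
    have hle : ∀ k, X k ≤ ((b k - d k : ℝ) : Rmax) := by
      intro k
      have h1 : L k k + X k ≤ (b k : Rmax) := by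
        rw [← hX k]
        exact Finset.le_sup (f := fun j => L k j + X j) (mem_univ k)
      rw [hdiag] at h1
      generalize X k = x at h1 ⊢
      induction x using WithBot.recBotCoe with
      | bot => exact bot_le
      | coe x =>
        rw [← WithBot.coe_add, WithBot.coe_le_coe] at h1
        rw [WithBot.coe_le_coe]
        linarith
    funext i
    refine le_antisymm (hle i) ?_
    by_contra hcon
    have hxi : X i < ((b i - d i : ℝ) : Rmax) := not_le.mp hcon
    have : mpMulVec L X i < (b i : Rmax) := by
      refine (Finset.sup_lt_iff (WithBot.bot_lt_coe _)).2 fun k _ => ?_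
      by_cases hk : k = i
      · subst hk
        rw [hdiag]
        generalize X k = x at hxi ⊢
        induction x using WithBot.recBotCoe with
        | bot => rw [WithBot.add_bot]; exact WithBot.bot_lt_coe _
        | coe x =>
          rw [WithBot.coe_lt_coe] at hxi
          rw [← WithBot.coe_add, WithBot.coe_lt_coe]
          linarith
      · exact lt_of_le_of_lt (add_le_add le_rfl (hle k)) (hlt i k hk)
    exact absurd (hX i) this.ne
end
end

section
/- Let L be an n×n lower triangular matrix over the max-plus algebra with l_{11} finite, and let b be a regular vector in (ℝ ∪ {−∞})^n. If l_{i1} + b_1 > b_i + l_{11} for some 2 ≤ i ≤ n (i.e. l_{i1} − l_{11} > b_i − b_1), then the system LX = b has no solution. -/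
open Finset

noncomputable section

/-- For a lower triangular `L` with `l 1 1` finite and a regular vector
`b`, if `l i 1 + b 1 > b i + l 1 1` for some `i > 1`, then `LX = b` has no solution. -/
theorem maxplus_L_system_no_solution {n : ℕ} (hn : 0 < n)
    (L : Fin n → Fin n → Rmax) (b : Fin n → ℝ)
    (hLtri : ∀ i j : Fin n, i < j → L i j = ⊥)
    (hL11 : L ⟨0, hn⟩ ⟨0, hn⟩ ≠ ⊥)
    (hbad : ∃ i : Fin n, (i : ℕ) ≠ 0 ∧
      (b i : Rmax) + L ⟨0, hn⟩ ⟨0, hn⟩ < L i ⟨0, hn⟩ + (b ⟨0, hn⟩ : Rmax)) :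
    ¬ ∃ X : Fin n → Rmax, ∀ i, mpMulVec L X i = (b i : Rmax) := by
  rintro ⟨X, hX⟩
  obtain ⟨i, -, hi⟩ := hbad
  have h0 : (b ⟨0, hn⟩ : Rmax) ≤ L ⟨0, hn⟩ ⟨0, hn⟩ + X ⟨0, hn⟩ := by
    rw [← hX]
    unfold mpMulVec
    refine Finset.sup_le fun k _ => ?_
    by_cases hk : k = ⟨0, hn⟩
    · rw [hk]
    · have hlt : (⟨0, hn⟩ : Fin n) < k := by
        rw [Fin.lt_def]
        exact Nat.pos_of_ne_zero fun h => hk (Fin.ext h)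
      rw [hLtri _ _ hlt, WithBot.bot_add]
      exact bot_le
  have h1 : L i ⟨0, hn⟩ + X ⟨0, hn⟩ ≤ (b i : Rmax) := by
    rw [← hX i]
    exact Finset.le_sup (f := fun k => L i k + X k) (Finset.mem_univ _)
  refine absurd hi (not_lt.mpr ?_)
  calc L i ⟨0, hn⟩ + (b ⟨0, hn⟩ : Rmax)
      ≤ L i ⟨0, hn⟩ + (L ⟨0, hn⟩ ⟨0, hn⟩ + X ⟨0, hn⟩) := add_le_add le_rfl h0
    _ = (L i ⟨0, hn⟩ + X ⟨0, hn⟩) + L ⟨0, hn⟩ ⟨0, hn⟩ := by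
        rw [add_comm (L ⟨0, hn⟩ ⟨0, hn⟩), add_assoc]
    _ ≤ (b i : Rmax) + L ⟨0, hn⟩ ⟨0, hn⟩ := add_le_add h1 le_rfl
end
end

section
/- Let U be an n×n upper triangular matrix over the max-plus algebra whose diagonal entries u_{11}, …, u_{nn} are all finite, and let b be a regular vector in (ℝ ∪ {−∞})^n. If u_{jk} + b_k ≤ b_j + u_{kk} for all indices 1 ≤ j < k ≤ n (i.e. u_{jk} − u_{kk} ≤ b_j − b_k), then the vector X* with entries x*_j = b_j − u_{jj} is a solution of the system UX = b, and every solution X of UX = b satisfies X ≤ X* entrywise. -/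
open Finset

noncomputable section

/-- If `U` is upper triangular with finite diagonal `d`, `b` is regular,
and `u j k + b k ≤ b j + u k k` for all `j < k`, then `X* = (b j − u j j)` solves
`UX = b` and every solution is `≤ X*` entrywise. -/
theorem maxplus_U_system_maximal_solution {n : ℕ} (U : Fin n → Fin n → Rmax)
    (d : Fin n → ℝ) (b : Fin n → ℝ)
    (hUtri : ∀ i j : Fin n, j < i → U i j = ⊥)
    (hdiag : ∀ i, U i i = (d i : Rmax))
    (hineq : ∀ j k : Fin n, j < k → U j k + (b k : Rmax) ≤ (b j : Rmax) + U k k) :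
    (∀ i, mpMulVec U (fun j => ((b j - d j : ℝ) : Rmax)) i = (b i : Rmax)) ∧
    ∀ X : Fin n → Rmax, (∀ i, mpMulVec U X i = (b i : Rmax)) →
      ∀ j, X j ≤ ((b j - d j : ℝ) : Rmax) := by
  constructor
  · intro i
    apply le_antisymm
    · apply Finset.sup_le
      intro k _
      rcases lt_trichotomy k i with h | h | h
      · simp [hUtri i k h]
      · subst h
        rw [hdiag, ← WithBot.coe_add, WithBot.coe_le_coe]
        linarith
      · have h1 := hineq i k h
        rw [hdiag] at h1
        generalize U i k = u at h1 ⊢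
        induction u using WithBot.recBotCoe with
        | bot => simp
        | coe u =>
          rw [← WithBot.coe_add, ← WithBot.coe_add, WithBot.coe_le_coe] at h1
          rw [← WithBot.coe_add, WithBot.coe_le_coe]
          linarith
    · have h1 : U i i + ((b i - d i : ℝ) : Rmax) ≤
          mpMulVec U (fun j => ((b j - d j : ℝ) : Rmax)) i :=
        Finset.le_sup (f := fun k => U i k + ((b k - d k : ℝ) : Rmax)) (Finset.mem_univ i)
      refine le_trans ?_ h1
      rw [hdiag, ← WithBot.coe_add, WithBot.coe_le_coe]
      linarith
  · intro X hX j
    have h1 : U j j + X j ≤ mpMulVec U X j :=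
      Finset.le_sup (f := fun k => U j k + X k) (Finset.mem_univ j)
    rw [hX, hdiag] at h1
    generalize X j = x at h1 ⊢
    induction x using WithBot.recBotCoe with
    | bot => simp
    | coe x =>
      rw [← WithBot.coe_add, WithBot.coe_le_coe] at h1
      rw [WithBot.coe_le_coe]
      linarith
end
end

section
/- Let U be an n×n upper triangular matrix over the max-plus algebra whose diagonal entries are all finite, and let b be a regular vector in (ℝ ∪ {−∞})^n. If the strict inequalities u_{jk} + b_k < b_j + u_{kk} hold for all indices 1 ≤ j < k ≤ n, then the vector X* with entries x*_j = b_j − u_{jj} is the unique solution of the system UX = b. -/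
open Finset

noncomputable section

/-- If `U` is upper triangular with finite diagonal `d`, `b` is regular,
and `u j k + b k < b j + u k k` strictly for all `j < k`, then `X* = (b j − u j j)` is the
unique solution of `UX = b`. -/
theorem maxplus_U_system_unique_solution {n : ℕ} (U : Fin n → Fin n → Rmax)
    (d : Fin n → ℝ) (b : Fin n → ℝ)
    (hUtri : ∀ i j : Fin n, j < i → U i j = ⊥)
    (hdiag : ∀ i, U i i = (d i : Rmax))
    (hineq : ∀ j k : Fin n, j < k → U j k + (b k : Rmax) < (b j : Rmax) + U k k) :
    (∀ i, mpMulVec U (fun j => ((b j - d j : ℝ) : Rmax)) i = (b i : Rmax)) ∧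
    ∀ X : Fin n → Rmax, (∀ i, mpMulVec U X i = (b i : Rmax)) →
      X = fun j => ((b j - d j : ℝ) : Rmax) := by
  have key : ∀ j k : Fin n, k ≠ j → ∀ x : Rmax, x ≤ ((b k - d k : ℝ) : Rmax) →
      U j k + x < (b j : Rmax) := by
    intro j k hkj x hx
    rcases lt_or_gt_of_ne hkj with h | h
    · rw [hUtri j k h, WithBot.bot_add]
      exact WithBot.bot_lt_coe _
    · have h1 := hineq j k h
      rw [hdiag k] at h1
      generalize U j k = u at h1 ⊢
      induction u using WithBot.recBotCoe with
      | bot => rw [WithBot.bot_add]; exact WithBot.bot_lt_coe _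
      | coe u =>
        induction x using WithBot.recBotCoe with
        | bot => rw [WithBot.add_bot]; exact WithBot.bot_lt_coe _
        | coe x =>
          rw [← WithBot.coe_add, ← WithBot.coe_add, WithBot.coe_lt_coe] at h1
          rw [WithBot.coe_le_coe] at hx
          rw [← WithBot.coe_add, WithBot.coe_lt_coe]
          linarith
  have hd : ∀ i, U i i + ((b i - d i : ℝ) : Rmax) = (b i : Rmax) := by
    intro i
    rw [hdiag, ← WithBot.coe_add, add_sub_cancel]
  constructor
  · intro i
    apply le_antisymm
    · refine Finset.sup_le fun k _ => ?_
      by_cases h : k = i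
      · subst h
        exact (hd k).le
      · exact (key i k h _ le_rfl).le
    · rw [← hd i]
      exact Finset.le_sup (f := fun k => U i k + ((b k - d k : ℝ) : Rmax)) (mem_univ i)
  · intro X hX
    have hle : ∀ k, X k ≤ ((b k - d k : ℝ) : Rmax) := by
      intro k
      have h1 : U k k + X k ≤ (b k : Rmax) := by
        rw [← hX k]
        exact Finset.le_sup (f := fun j => U k j + X j) (mem_univ k)
      rw [hdiag] at h1
      generalize X k = x at h1 ⊢
      induction x using WithBot.recBotCoe with
      | bot => exact bot_le
      | coe x =>
        rw [← WithBot.coe_add, WithBot.coe_le_coe] at h1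
        rw [WithBot.coe_le_coe]
        linarith
    funext j
    refine le_antisymm (hle j) ?_
    by_contra hlt
    rw [not_le] at hlt
    have : mpMulVec U X j < (b j : Rmax) := by
      refine (Finset.sup_lt_iff (WithBot.bot_lt_coe _)).2 fun k _ => ?_
      by_cases h : k = j
      · subst h
        rw [hdiag]
        generalize X k = x at hlt ⊢
        induction x using WithBot.recBotCoe with
        | bot => rw [WithBot.add_bot]; exact WithBot.bot_lt_coe _
        | coe x =>
          rw [WithBot.coe_lt_coe] at hlt
          rw [← WithBot.coe_add, WithBot.coe_lt_coe]
          linarith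
      · exact key j k h _ (hle k)
    exact this.ne (hX j)
end
end

section
/- Let A be an n×n matrix over the max-plus algebra whose diagonal entries are all finite and which has LU factors, i.e. A = L_A U_A, and let b be a regular vector in (ℝ ∪ {−∞})^n. If a_{ik} + b_k ≤ b_i + a_{kk} for all pairs of indices i ≠ k (i.e. a_{ik} − a_{kk} ≤ b_i − b_k), then the vector X* with entries x*_i = b_i − a_{ii} is a solution of the system AX = b, and every solution X of AX = b satisfies X ≤ X* entrywise. -/
open Finset

noncomputable section

/-- If `A` has finite diagonal `d`, has LU factors (`A = L_A U_A`),
`b` is regular, and `a i k + b k ≤ b i + a k k` for all `i ≠ k`, then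
`X* = (b i − a i i)` solves `AX = b` and every solution is `≤ X*` entrywise. -/
theorem maxplus_LU_system_maximal_solution {n : ℕ} (A : Fin n → Fin n → Rmax)
    (d : Fin n → ℝ) (b : Fin n → ℝ)
    (hdiag : ∀ i, A i i = (d i : Rmax))
    (hLU : mpMulMat (Lfac A d) (Ufac A) = A)
    (hineq : ∀ i k : Fin n, i ≠ k → A i k + (b k : Rmax) ≤ (b i : Rmax) + A k k) :
    (∀ i, mpMulVec A (fun j => ((b j - d j : ℝ) : Rmax)) i = (b i : Rmax)) ∧
    ∀ X : Fin n → Rmax, (∀ i, mpMulVec A X i = (b i : Rmax)) →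
      ∀ i, X i ≤ ((b i - d i : ℝ) : Rmax) := by
  constructor
  · intro i
    unfold mpMulVec
    apply le_antisymm
    · apply Finset.sup_le
      intro k _
      by_cases h : i = k
      · subst h
        rw [hdiag, ← WithBot.coe_add]
        apply le_of_eq
        congr 1
        ring
      · have h1 := hineq i k h
        rw [hdiag] at h1
        revert h1
        induction A i k using WithBot.recBotCoe with
        | bot => intro _; simp
        | coe a =>
          intro h1
          rw [← WithBot.coe_add, ← WithBot.coe_add, WithBot.coe_le_coe] at h1
          rw [← WithBot.coe_add, WithBot.coe_le_coe]
          linarith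
    · refine le_trans (le_of_eq ?_) (Finset.le_sup (Finset.mem_univ i))
      rw [hdiag, ← WithBot.coe_add]
      congr 1
      ring
  · intro X hX i
    have h1 : A i i + X i ≤ (b i : Rmax) := by
      rw [← hX i]
      exact Finset.le_sup (f := fun k => A i k + X k) (Finset.mem_univ i)
    rw [hdiag] at h1
    revert h1
    induction X i using WithBot.recBotCoe with
    | bot => intro _; exact bot_le
    | coe a =>
      intro h1
      rw [← WithBot.coe_add, WithBot.coe_le_coe] at h1
      rw [WithBot.coe_le_coe]
      linarith
end
end

section
/- Let A be an n×n matrix over the max-plus algebra whose diagonal entries are all finite and which has LU factors, i.e. A = L_A U_A, and let b be a regular vector in (ℝ ∪ {−∞})^n. If the strict inequalities a_{ik} + b_k < b_i + a_{kk} hold for all pairs of indices i ≠ k, then the vector X* with entries x*_i = b_i − a_{ii} is the unique solution of the system AX = b. -/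
open Finset

noncomputable section

/-- If `A` has finite diagonal `d`, has LU factors (`A = L_A U_A`),
`b` is regular, and `a i k + b k < b i + a k k` strictly for all `i ≠ k`, then
`X* = (b i − a i i)` is the unique solution of `AX = b`. -/
theorem maxplus_LU_system_unique_solution {n : ℕ} (A : Fin n → Fin n → Rmax)
    (d : Fin n → ℝ) (b : Fin n → ℝ)
    (hdiag : ∀ i, A i i = (d i : Rmax))
    (hLU : mpMulMat (Lfac A d) (Ufac A) = A)
    (hineq : ∀ i k : Fin n, i ≠ k → A i k + (b k : Rmax) < (b i : Rmax) + A k k) :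
    (∀ i, mpMulVec A (fun j => ((b j - d j : ℝ) : Rmax)) i = (b i : Rmax)) ∧
    ∀ X : Fin n → Rmax, (∀ i, mpMulVec A X i = (b i : Rmax)) →
      X = fun j => ((b j - d j : ℝ) : Rmax) := by
  have key : ∀ i k : Fin n, i ≠ k → A i k + ((b k - d k : ℝ) : Rmax) < (b i : Rmax) := by
    intro i k hik
    have h := hineq i k hik
    rw [hdiag k] at h
    cases hA : (A i k) using WithBot.recBotCoe with
    | bot => rw [WithBot.bot_add]; exact WithBot.bot_lt_coe _
    | coe a =>
      rw [hA] at h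
      norm_cast at h ⊢
      linarith
  have diag : ∀ i, A i i + ((b i - d i : ℝ) : Rmax) = (b i : Rmax) := by
    intro i
    rw [hdiag i]
    norm_cast
    ring
  constructor
  · intro i
    apply le_antisymm
    · refine Finset.sup_le fun k _ => ?_
      by_cases hik : i = k
      · subst hik
        exact (diag i).le
      · exact (key i k hik).le
    · refine le_trans (diag i).ge ?_
      exact Finset.le_sup (f := fun k => A i k + ((b k - d k : ℝ) : Rmax)) (Finset.mem_univ i)
  · intro X hX
    have hle : ∀ k, X k ≤ ((b k - d k : ℝ) : Rmax) := by
      intro k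
      have h : A k k + X k ≤ (b k : Rmax) := by
        rw [← hX k]
        exact Finset.le_sup (f := fun j => A k j + X j) (Finset.mem_univ k)
      rw [hdiag k] at h
      cases hx : (X k) using WithBot.recBotCoe with
      | bot => exact bot_le
      | coe x =>
        rw [hx] at h
        norm_cast at h ⊢
        linarith
    funext i
    obtain ⟨k, _, hk⟩ := Finset.exists_mem_eq_sup (univ : Finset (Fin n)) ⟨i, Finset.mem_univ i⟩
      (fun j => A i j + X j)
    have hk2 : (b i : Rmax) = A i k + X k := by
      rw [← hX i]
      exact hk
    by_cases hik : i = k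
    · subst hik
      rw [hdiag i] at hk2
      cases hx : (X i) using WithBot.recBotCoe with
      | bot => rw [hx, WithBot.add_bot] at hk2; exact absurd hk2 WithBot.coe_ne_bot
      | coe x =>
        rw [hx] at hk2
        norm_cast at hk2 ⊢
        linarith
    · exfalso
      have h1 : A i k + X k ≤ A i k + ((b k - d k : ℝ) : Rmax) := by
        gcongr
        exact hle k
      exact absurd (lt_of_le_of_lt (hk2.le.trans h1) (key i k hik)) (lt_irrefl _)
end
end

section
/- Let S be an idempotent semifield whose addition is the maximum for its total order, and let A be an n×n matrix over S whose diagonal entries a_{11}, …, a_{nn} are all nonzero and which satisfies a_{1σ(1)} ⊗ ⋯ ⊗ a_{nσ(n)} ≤ a_{11} ⊗ ⋯ ⊗ a_{nn} for every permutation σ of {1,…,n} (i.e. det_ε(A) = a_{11} ⊗ ⋯ ⊗ a_{nn}). Define the lower triangular matrix L by L_{ij} = a_{ij} ⊗ a_{jj}^{-1} for i ≥ j and L_{ij} = 0 for i < j, and the upper triangular matrix U by U_{ij} = a_{ij} for i ≤ j and U_{ij} = 0 for i > j. Then A = LU if and only if for all indices i, j with 1 < i, j ≤ n and i ≠ j one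 has a_{ij} = max_{k=1}^{min(i,j)−1} ( max(a_{kk} ⊗ a_{ij}, a_{ik} ⊗ a_{kj}) ⊗ a_{kk}^{-1} ). -/
open Finset

noncomputable section

/- An idempotent semifield whose addition is the maximum for its total order is modeled by a
`LinearOrderedCommGroupWithZero`: the nonzero elements form a linearly ordered abelian group,
`0` is an absorbing least element, the semifield addition is `a ⊕ b = max a b`, and every
nonzero element is invertible. -/

/-- Supremum (semifield sum) of finitely many elements of an idempotent semifield;
`0` is the least element. -/
noncomputable def gSupOn {S : Type*} [LinearOrderedCommGroupWithZero S] {n : ℕ}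
    (s : Finset (Fin n)) (f : Fin n → S) : S :=
  letI : Bot S := ⟨0⟩
  letI : OrderBot S := { bot_le := fun _ => zero_le' }
  s.sup f

/-- Supremum (semifield sum) over all indices. -/
noncomputable def gSup {S : Type*} [LinearOrderedCommGroupWithZero S] {n : ℕ}
    (f : Fin n → S) : S :=
  gSupOn univ f

/-- Matrix product over an idempotent semifield: `(A ⬝ B) i j = max_k (A i k * B k j)`. -/
noncomputable def gMulMat {S : Type*} [LinearOrderedCommGroupWithZero S] {n : ℕ}
    (A B : Fin n → Fin n → S) : Fin n → Fin n → S :=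
  fun i j => gSup fun k => A i k * B k j

/-- Matrix-vector product over an idempotent semifield: `(A ⬝ x) i = max_k (A i k * x k)`. -/
noncomputable def gMulVec {S : Type*} [LinearOrderedCommGroupWithZero S] {n : ℕ}
    (A : Fin n → Fin n → S) (x : Fin n → S) : Fin n → S :=
  fun i => gSup fun k => A i k * x k

/-- The lower triangular factor `L` of `A`: `L i j = A i j * (A j j)⁻¹` for `j ≤ i`. -/
noncomputable def gLfac {S : Type*} [LinearOrderedCommGroupWithZero S] {n : ℕ}
    (A : Fin n → Fin n → S) : Fin n → Fin n → S :=
  fun i j => if j ≤ i then A i j * (A j j)⁻¹ else 0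

/-- The upper triangular factor `U` of `A`: `U i j = A i j` for `i ≤ j`. -/
noncomputable def gUfac {S : Type*} [LinearOrderedCommGroupWithZero S] {n : ℕ}
    (A : Fin n → Fin n → S) : Fin n → Fin n → S :=
  fun i j => if i ≤ j then A i j else 0

theorem gSupOn_le_iff_aux {S : Type*} [LinearOrderedCommGroupWithZero S] {n : ℕ}
    (s : Finset (Fin n)) (f : Fin n → S) (a : S) :
    gSupOn s f ≤ a ↔ ∀ k ∈ s, f k ≤ a := by
  letI : Bot S := ⟨0⟩
  letI : OrderBot S := { bot_le := fun _ => zero_le' }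
  exact Finset.sup_le_iff

theorem le_gSupOn_aux {S : Type*} [LinearOrderedCommGroupWithZero S] {n : ℕ}
    (s : Finset (Fin n)) (f : Fin n → S) (k : Fin n) (hk : k ∈ s) :
    f k ≤ gSupOn s f := (gSupOn_le_iff_aux s f _).1 le_rfl k hk

theorem diag_aux {S : Type*} [LinearOrderedCommGroupWithZero S]
    {n : ℕ} (A : Fin n → Fin n → S)
    (hdiag : ∀ i, A i i ≠ 0)
    (hdet : ∀ σ : Equiv.Perm (Fin n), ∏ i, A i (σ i) ≤ ∏ i, A i i)
    (i k : Fin n) (hk : k ≠ i) : A i k * A k i ≤ A i i * A k k := by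
  have h := hdet (Equiv.swap i k)
  have hm : k ∈ univ.erase i := by simp [hk]
  rw [← Finset.mul_prod_erase univ _ (mem_univ i), ← Finset.mul_prod_erase _ _ hm,
    ← Finset.mul_prod_erase univ (fun i => A i i) (mem_univ i),
    ← Finset.mul_prod_erase _ (fun i => A i i) hm, ← mul_assoc, ← mul_assoc] at h
  have e : ∏ x ∈ (univ.erase i).erase k, A x (Equiv.swap i k x)
      = ∏ x ∈ (univ.erase i).erase k, A x x := by
    apply Finset.prod_congr rfl
    intro x hx
    simp only [Finset.mem_erase] at hx
    rw [Equiv.swap_apply_of_ne_of_ne hx.2.1 hx.1]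
  rw [e, Equiv.swap_apply_left, Equiv.swap_apply_right] at h
  have hp : 0 < ∏ x ∈ (univ.erase i).erase k, A x x :=
    zero_lt_iff.2 (Finset.prod_ne_zero_iff.2 fun x _ => hdiag x)
  exact le_of_mul_le_mul_right h hp

theorem lu_iff_aux {S : Type*} [LinearOrderedCommGroupWithZero S]
    {n : ℕ} (A : Fin n → Fin n → S) (hdiag : ∀ i, A i i ≠ 0) (i j : Fin n) :
    gMulMat (gLfac A) (gUfac A) i j = A i j ↔
      ∀ k : Fin n, k < i → k < j → A i k * A k j * (A k k)⁻¹ ≤ A i j := by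
  have lo : A i j ≤ gMulMat (gLfac A) (gUfac A) i j := by
    refine le_trans (le_of_eq ?_) (le_gSupOn_aux univ _ (min i j) (mem_univ _))
    rcases le_total i j with h | h
    · simp [gLfac, gUfac, h, hdiag]
    · simp [gLfac, gUfac, h, hdiag]
  constructor
  · intro h k hi hj
    rw [← h]
    refine le_trans (le_of_eq ?_) (le_gSupOn_aux univ _ k (mem_univ _))
    simp only [gLfac, gUfac, hi.le, hj.le, if_true]
    exact mul_right_comm _ _ _
  · intro h
    refine le_antisymm ?_ lo
    unfold gMulMat gSup
    refine (gSupOn_le_iff_aux _ _ _).2 fun k _ => ?_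
    simp only [gLfac, gUfac]
    split_ifs with h1 h2
    · rcases h1.eq_or_lt with rfl | h1
      · simp [hdiag]
      rcases h2.eq_or_lt with rfl | h2
      · simp [hdiag]
      rw [mul_right_comm]
      exact h k h1 h2
    all_goals simp

/-- Over an idempotent semifield, for `A` with nonzero diagonal and
`det_ε(A) = a₁₁ ⊗ ⋯ ⊗ aₙₙ`, one has `A = LU` iff for all `1 < i, j ≤ n` with `i ≠ j`,
`a i j = max_{k < min i j} (max(a k k * a i j, a i k * a k j) * (a k k)⁻¹)`. -/
theorem semifield_LU_factorization_iff {S : Type*} [LinearOrderedCommGroupWithZero S]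
    {n : ℕ} (A : Fin n → Fin n → S)
    (hdiag : ∀ i, A i i ≠ 0)
    (hdet : ∀ σ : Equiv.Perm (Fin n), ∏ i, A i (σ i) ≤ ∏ i, A i i) :
    gMulMat (gLfac A) (gUfac A) = A ↔
      ∀ i j : Fin n, (i : ℕ) ≠ 0 → (j : ℕ) ≠ 0 → i ≠ j →
        A i j =
          gSupOn (univ.filter fun k : Fin n => (k : ℕ) < min (i : ℕ) (j : ℕ))
            (fun k => max (A k k * A i j) (A i k * A k j) * (A k k)⁻¹) := by
  have key : ∀ i j k : Fin n, max (A k k * A i j) (A i k * A k j) * (A k k)⁻¹ =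
      max (A i j) (A i k * A k j * (A k k)⁻¹) := by
    intro i j k
    have hm : Monotone (fun x : S => x * (A k k)⁻¹) := fun x y h => mul_le_mul_left h _
    have := hm.map_max (a := A k k * A i j) (b := A i k * A k j)
    rw [this, mul_right_comm, mul_inv_cancel₀ (hdiag k), one_mul]
  simp only [key]
  constructor
  · intro h i j hi hj _
    have h' := (lu_iff_aux A hdiag i j).1 (congrFun (congrFun h i) j)
    apply le_antisymm
    · refine le_trans (le_max_left _ _) (le_gSupOn_aux _ (fun k => max (A i j) (A i k * A k j * (A k k)⁻¹)) ⟨0, i.pos⟩ ?_)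
      simp only [mem_filter, mem_univ, true_and]
      omega
    · refine (gSupOn_le_iff_aux _ _ _).2 fun k hk => ?_
      simp only [mem_filter, mem_univ, true_and, lt_min_iff] at hk
      exact max_le le_rfl (h' k hk.1 hk.2)
  · intro h
    funext i j
    refine (lu_iff_aux A hdiag i j).2 fun k hi hj => ?_
    by_cases hij : i = j
    · subst hij
      rw [mul_inv_le_iff₀ (zero_lt_iff.2 (hdiag k))]
      exact diag_aux A hdiag hdet i k hi.ne
    · have hi' : (k : ℕ) < i := hi
      have hj' : (k : ℕ) < j := hj
      have := (gSupOn_le_iff_aux _ _ _).1 (h i j (by omega) (by omega) hij).ge k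
        (by simp only [mem_filter, mem_univ, true_and]; omega)
      exact le_trans (le_max_right _ _) this
end
end

section
/- Let S be an idempotent semifield whose addition is the maximum for its total order, let L be an n×n lower triangular matrix over S whose diagonal entries are all nonzero, and let b ∈ S^n be a regular vector. If L_{ik} ⊗ b_k ≤ b_i ⊗ L_{kk} for all indices 2 ≤ i ≤ n and 1 ≤ k ≤ i−1 (i.e. L_{ik} ⊗ L_{kk}^{-1} ≤ b_i ⊗ b_k^{-1}), then the vector X* with entries x*_i = b_i ⊗ L_{ii}^{-1} is a solution of the system LX = b and every solution X satisfies X ≤ X* entrywise; moreover, if all these inequalities are strict, then X* is the unique solution of LX = b. -/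
open Finset

noncomputable section

theorem gSup_le_iff' {S : Type*} [LinearOrderedCommGroupWithZero S] {n : ℕ}
    (f : Fin n → S) (a : S) : gSup f ≤ a ↔ ∀ k, f k ≤ a := by
  letI : Bot S := ⟨0⟩
  letI : OrderBot S := { bot_le := fun _ => zero_le' }
  have h : univ.sup f ≤ a ↔ ∀ k ∈ univ, f k ≤ a := Finset.sup_le_iff
  exact h.trans ⟨fun h k => h k (mem_univ k), fun h k _ => h k⟩

theorem le_gSup' {S : Type*} [LinearOrderedCommGroupWithZero S] {n : ℕ}
    (f : Fin n → S) (k : Fin n) : f k ≤ gSup f :=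
  (gSup_le_iff' f _).1 le_rfl k

theorem exists_gSup' {S : Type*} [LinearOrderedCommGroupWithZero S] {n : ℕ}
    (f : Fin n → S) (i : Fin n) : ∃ k, f k = gSup f := by
  obtain ⟨k, -, hk⟩ := Finset.exists_max_image univ f ⟨i, mem_univ i⟩
  exact ⟨k, le_antisymm (le_gSup' f k) ((gSup_le_iff' f _).2 fun j => hk j (mem_univ j))⟩

/-- Over an idempotent semifield, if `L` is lower triangular with nonzero
diagonal, `b` is regular, and `L i k * b k ≤ b i * L k k` for all `k < i`, then
`X* = (b i * (L i i)⁻¹)` solves `LX = b` and every solution is `≤ X*`; if moreover all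
these inequalities are strict, then `X*` is the unique solution. -/
theorem semifield_L_system_solution {S : Type*} [LinearOrderedCommGroupWithZero S]
    {n : ℕ} (L : Fin n → Fin n → S) (b : Fin n → S)
    (hLtri : ∀ i j : Fin n, i < j → L i j = 0)
    (hdiag : ∀ i, L i i ≠ 0)
    (hb : ∀ i, b i ≠ 0)
    (hineq : ∀ i k : Fin n, k < i → L i k * b k ≤ b i * L k k) :
    ((∀ i, gMulVec L (fun j => b j * (L j j)⁻¹) i = b i) ∧
      ∀ X : Fin n → S, (∀ i, gMulVec L X i = b i) → ∀ i, X i ≤ b i * (L i i)⁻¹) ∧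
    ((∀ i k : Fin n, k < i → L i k * b k < b i * L k k) →
      ∀ X : Fin n → S, (∀ i, gMulVec L X i = b i) → X = fun j => b j * (L j j)⁻¹) := by
  have hle : ∀ X : Fin n → S, (∀ i, gMulVec L X i = b i) → ∀ i, X i ≤ b i * (L i i)⁻¹ := by
    intro X hX i
    have h : L i i * X i ≤ b i := (le_gSup' (fun k => L i k * X k) i).trans_eq (hX i)
    rw [le_mul_inv_iff₀ (zero_lt_iff.2 (hdiag i)), mul_comm]
    exact h
  refine ⟨⟨fun i => ?_, hle⟩, fun hs X hX => funext fun i => ?_⟩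
  · apply le_antisymm
    · refine (gSup_le_iff' _ _).2 fun k => ?_
      rcases lt_trichotomy k i with h | h | h
      · rw [← mul_assoc, mul_inv_le_iff₀ (zero_lt_iff.2 (hdiag k))]
        exact hineq i k h
      · subst h
        rw [mul_comm, inv_mul_cancel_right₀ (hdiag k)]
      · rw [hLtri i k h, zero_mul]
        exact zero_le'
    · refine le_trans (le_of_eq ?_) (le_gSup' _ i)
      rw [mul_comm, inv_mul_cancel_right₀ (hdiag i)]
  · obtain ⟨k, hk⟩ := exists_gSup' (fun k => L i k * X k) i
    have hk2 : L i k * X k = b i := hk.trans (hX i)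
    rcases lt_trichotomy k i with h | h | h
    · exfalso
      have h1 : L i k * X k ≤ L i k * (b k * (L k k)⁻¹) := mul_le_mul_right (hle X hX k) _
      have h2 : L i k * (b k * (L k k)⁻¹) < b i := by
        rw [← mul_assoc, mul_inv_lt_iff₀ (zero_lt_iff.2 (hdiag k))]
        exact hs i k h
      exact absurd hk2 (h1.trans_lt h2).ne
    · subst h
      rw [eq_mul_inv_iff_mul_eq₀ (hdiag k), mul_comm]
      exact hk2
    · rw [hLtri i k h, zero_mul] at hk2
      exact absurd hk2.symm (hb i)
end
end

section
/- Let S be an idempotent semifield whose addition is the maximum for its total order, let A be an n×n matrix over S whose diagonal entries are all nonzero and which has LU factors, i.e. A = LU where L_{ij} = a_{ij} ⊗ a_{jj}^{-1} for i ≥ j, L_{ij} = 0 for i < j, U_{ij} = a_{ij} for i ≤ j, U_{ij} = 0 for i > j, and let b ∈ S^n be a regular vector. If a_{ik} ⊗ b_k ≤ b_i ⊗ a_{kk} for all pairs of indices i ≠ k (i.e. a_{ik} ⊗ a_{kk}^{-1} ≤ b_i ⊗ b_k^{-1}), then the vector X* with entries x*_i = b_i ⊗ a_{ii}^{-1} is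 a solution of the system AX = b and every solution X satisfies X ≤ X* entrywise; moreover, if all these inequalities are strict, then X* is the unique solution of AX = b. -/
open Finset

noncomputable section

theorem gSup_le_iff_aux {S : Type*} [LinearOrderedCommGroupWithZero S] {n : ℕ}
    (f : Fin n → S) (c : S) : gSup f ≤ c ↔ ∀ k, f k ≤ c := by
  letI : Bot S := ⟨0⟩
  letI : OrderBot S := { bot_le := fun _ => zero_le' }
  have : univ.sup f ≤ c ↔ ∀ k ∈ univ, f k ≤ c := Finset.sup_le_iff
  exact this.trans (by simp)

theorem gSup_lt_aux {S : Type*} [LinearOrderedCommGroupWithZero S] {n : ℕ}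
    (f : Fin n → S) (c : S) (hc : 0 < c) (h : ∀ k, f k < c) : gSup f < c := by
  letI : Bot S := ⟨0⟩
  letI : OrderBot S := { bot_le := fun _ => zero_le' }
  have : univ.sup f < c := (Finset.sup_lt_iff hc).2 fun k _ => h k
  exact this

/-- Over an idempotent semifield, if `A` has nonzero diagonal and LU
factors (`A = LU`), `b` is regular, and `A i k * b k ≤ b i * A k k` for all `i ≠ k`, then
`X* = (b i * (A i i)⁻¹)` solves `AX = b` and every solution is `≤ X*`; if moreover all
these inequalities are strict, then `X*` is the unique solution. -/
theorem semifield_LU_system_solution {S : Type*} [LinearOrderedCommGroupWithZero S]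
    {n : ℕ} (A : Fin n → Fin n → S) (b : Fin n → S)
    (hdiag : ∀ i, A i i ≠ 0)
    (hLU : gMulMat (gLfac A) (gUfac A) = A)
    (hb : ∀ i, b i ≠ 0)
    (hineq : ∀ i k : Fin n, i ≠ k → A i k * b k ≤ b i * A k k) :
    ((∀ i, gMulVec A (fun j => b j * (A j j)⁻¹) i = b i) ∧
      ∀ X : Fin n → S, (∀ i, gMulVec A X i = b i) → ∀ i, X i ≤ b i * (A i i)⁻¹) ∧
    ((∀ i k : Fin n, i ≠ k → A i k * b k < b i * A k k) →
      ∀ X : Fin n → S, (∀ i, gMulVec A X i = b i) → X = fun j => b j * (A j j)⁻¹) := by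
  have key : ∀ X : Fin n → S, (∀ i, gMulVec A X i = b i) → ∀ i, X i ≤ b i * (A i i)⁻¹ := by
    intro X hX i
    have h : A i i * X i ≤ b i := by
      rw [← hX i]
      exact (gSup_le_iff_aux (fun k => A i k * X k) _).1 le_rfl i
    rw [le_mul_inv_iff₀ (zero_lt_iff.2 (hdiag i)), mul_comm]
    exact h
  refine ⟨⟨?_, key⟩, ?_⟩
  · intro i
    apply le_antisymm
    · refine (gSup_le_iff_aux _ _).2 fun k => ?_
      by_cases hik : i = k
      · subst hik
        rw [mul_comm, inv_mul_cancel_right₀ (hdiag i)]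
      · rw [← mul_assoc, mul_inv_le_iff₀ (zero_lt_iff.2 (hdiag k))]
        exact hineq i k hik
    · have h := (gSup_le_iff_aux (fun k => A i k * (b k * (A k k)⁻¹)) _).1 le_rfl i
      have e : A i i * (b i * (A i i)⁻¹) = b i := by
        rw [mul_comm, inv_mul_cancel_right₀ (hdiag i)]
      simp only [e] at h
      exact h
  · intro hs X hX
    funext i
    by_contra hne
    have hlt : X i < b i * (A i i)⁻¹ := lt_of_le_of_ne (key X hX i) hne
    have : gMulVec A X i < b i := by
      refine gSup_lt_aux _ _ (zero_lt_iff.2 (hb i)) fun k => ?_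
      by_cases hik : i = k
      · subst hik
        rw [lt_mul_inv_iff₀ (zero_lt_iff.2 (hdiag i)), mul_comm] at hlt
        exact hlt
      · refine lt_of_le_of_lt (mul_le_mul_right (key X hX k) (A i k)) ?_
        rw [← mul_assoc, mul_inv_lt_iff₀ (zero_lt_iff.2 (hdiag k))]
        exact hs i k hik
    exact absurd (hX i) this.ne
end
end

section
/- Let S be an idempotent semifield whose addition is the maximum for its total order, and let A be an n×n matrix over S. Then A admits a factorization A = LU, where L is an invertible lower triangular matrix all of whose diagonal entries equal 1 and U is an invertible upper triangular matrix all of whose diagonal entries are invertible in S, if and only if A is a diagonal matrix all of whose diagonal entries are nonzero. -/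
open Finset

noncomputable section

/-- The identity matrix over an idempotent semifield. -/
def gId {S : Type*} [LinearOrderedCommGroupWithZero S] (n : ℕ) : Fin n → Fin n → S :=
  fun i j => if i = j then 1 else 0

/-- A matrix is invertible if it has a two-sided inverse for the semifield matrix product. -/
def gInvertible {S : Type*} [LinearOrderedCommGroupWithZero S] {n : ℕ}
    (M : Fin n → Fin n → S) : Prop :=
  ∃ M' : Fin n → Fin n → S, gMulMat M M' = gId n ∧ gMulMat M' M = gId n

theorem aux_le {S : Type*} [LinearOrderedCommGroupWithZero S] {n : ℕ}
    (f : Fin n → S) (i : Fin n) : f i ≤ gSup f := by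
  letI : Bot S := ⟨0⟩
  letI : OrderBot S := { bot_le := fun _ => zero_le' }
  exact Finset.le_sup (f := f) (Finset.mem_univ i)

theorem aux_sup_le {S : Type*} [LinearOrderedCommGroupWithZero S] {n : ℕ}
    (f : Fin n → S) (a : S) (h : ∀ i, f i ≤ a) : gSup f ≤ a := by
  letI : Bot S := ⟨0⟩
  letI : OrderBot S := { bot_le := fun _ => zero_le' }
  exact Finset.sup_le (s := Finset.univ) (f := f) (fun i _ => h i)

theorem aux_single {S : Type*} [LinearOrderedCommGroupWithZero S] {n : ℕ}
    (f : Fin n → S) (i : Fin n) (h : ∀ j, j ≠ i → f j = 0) : gSup f = f i := by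
  apply le_antisymm _ (aux_le f i)
  apply aux_sup_le
  intro j
  by_cases hj : j = i
  · rw [hj]
  · rw [h j hj]; exact zero_le'

theorem aux_mul_diag {S : Type*} [LinearOrderedCommGroupWithZero S] {n : ℕ}
    (L U : Fin n → Fin n → S) (h : ∀ i j, i ≠ j → L i j = 0) (i j : Fin n) :
    gMulMat L U i j = L i i * U i j := by
  unfold gMulMat
  rw [aux_single _ i]
  intro k hk
  rw [h i k (Ne.symm hk), zero_mul]

theorem aux_inv_diag {S : Type*} [LinearOrderedCommGroupWithZero S] {n : ℕ}
    (M : Fin n → Fin n → S) (hd : ∀ i, M i i ≠ 0) (hM : gInvertible M) (i j : Fin n)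
    (hij : i ≠ j) : M i j = 0 := by
  obtain ⟨M', h1, -⟩ := hM
  have hz : ∀ i j k, i ≠ j → M i k * M' k j = 0 := by
    intro i j k hij
    have h := aux_le (fun k => M i k * M' k j) k
    have h2 : gSup (fun k => M i k * M' k j) = 0 := by
      have := congrFun (congrFun h1 i) j
      simpa [gMulMat, gId, hij] using this
    rw [h2] at h
    exact le_antisymm h zero_le'
  have hM' : ∀ i j, i ≠ j → M' i j = 0 := fun i j hij =>
    (mul_eq_zero.mp (hz i j i hij)).resolve_left (hd i)
  have hjj : M j j * M' j j = 1 := by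
    have h3 := congrFun (congrFun h1 j) j
    unfold gMulMat at h3
    rw [aux_single _ j (fun k hk => by rw [hM' k j hk, mul_zero])] at h3
    simpa [gId] using h3
  exact (mul_eq_zero.mp (hz i j j hij)).resolve_right (right_ne_zero_of_mul_eq_one hjj)

theorem aux_diag_inv {S : Type*} [LinearOrderedCommGroupWithZero S] {n : ℕ}
    (M : Fin n → Fin n → S) (hd : ∀ i, M i i ≠ 0) (hM : ∀ i j, i ≠ j → M i j = 0) :
    gInvertible M := by
  refine ⟨fun i j => if i = j then (M i i)⁻¹ else 0, ?_, ?_⟩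
  · funext i j
    rw [aux_mul_diag _ _ hM]
    by_cases h : i = j <;> simp [gId, h, hd]
  · funext i j
    rw [aux_mul_diag _ _ (fun i j h => by simp [h])]
    by_cases h : i = j
    · subst h; simp [gId, hd]
    · simp [gId, h, hM i j h]

/-- Over an idempotent semifield, `A` admits a factorization `A = LU`
with `L` an invertible lower triangular matrix with all diagonal entries equal to `1` and
`U` an invertible upper triangular matrix with invertible diagonal entries, iff `A` is a
diagonal matrix with nonzero diagonal entries. -/
theorem semifield_LU_iff_diagonal {S : Type*} [LinearOrderedCommGroupWithZero S]
    {n : ℕ} (A : Fin n → Fin n → S) :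
    (∃ L U : Fin n → Fin n → S,
      (∀ i j : Fin n, i < j → L i j = 0) ∧ (∀ i, L i i = 1) ∧ gInvertible L ∧
      (∀ i j : Fin n, j < i → U i j = 0) ∧ (∀ i, IsUnit (U i i)) ∧ gInvertible U ∧
      gMulMat L U = A) ↔
      ((∀ i j : Fin n, i ≠ j → A i j = 0) ∧ ∀ i, A i i ≠ 0) := by
  constructor
  · rintro ⟨L, U, -, hL1, hLi, -, hU1, hUi, rfl⟩
    have hL := aux_inv_diag L (fun i => by rw [hL1 i]; exact one_ne_zero) hLi
    have hU := aux_inv_diag U (fun i => (hU1 i).ne_zero) hUi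
    refine ⟨fun i j hij => ?_, fun i => ?_⟩
    · rw [aux_mul_diag _ _ hL, hU i j hij, mul_zero]
    · rw [aux_mul_diag _ _ hL, hL1, one_mul]
      exact (hU1 i).ne_zero
  · rintro ⟨h0, hd⟩
    have hI : ∀ i j : Fin n, i ≠ j → (gId n i j : S) = 0 := fun i j h => by simp [gId, h]
    have hI1 : ∀ i : Fin n, (gId n i i : S) = 1 := fun i => by simp [gId]
    refine ⟨gId n, A, fun i j h => hI i j h.ne, hI1,
      aux_diag_inv _ (fun i => by rw [hI1]; exact one_ne_zero) hI,
      fun i j h => h0 i j h.ne', fun i => (hd i).isUnit, aux_diag_inv A hd h0, ?_⟩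
    funext i j
    rw [aux_mul_diag _ _ hI, hI1, one_mul]
end
end
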